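/- Assume the generalized continuum hypothesis, i.e. 2^μ = μ⁺ for every infinite cardinal μ. Then for every uncountable cardinal κ there exists a group 𝔾_κ with a complete bi-invariant metric having a dense subset of cardinality at most κ, such that every group equipped with a bi-invariant metric that has a dense subset of cardinality at most κ admits an isometric group monomorphism into 𝔾_κ. -/

import Mathlib

/-- The metric of the metric space `G` is bi-invariant with respect to the group structure. -/
def BiInvariantDist (G : Type*) [Group G] [MetricSpace G] : Prop :=
  ∀ g x y : G, dist (g * x) (g * y) = dist x y ∧ dist (x * g) (y * g) = dist x y

/-- Conjugation-invariant seminorms on groups. -/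
structure ConjSeminorm {G : Type} [Group G] (N : G → ℝ) : Prop where
  one : N 1 = 0
  inv : ∀ a, N a⁻¹ = N a
  mul : ∀ a b, N (a * b) ≤ N a + N b
  conj : ∀ a b, N (a * b * a⁻¹) = N b

namespace ConjSeminorm

variable {G : Type} [Group G] {N : G → ℝ}

theorem nonneg (h : ConjSeminorm N) (a : G) : 0 ≤ N a := by
  have := h.mul a a⁻¹
  rw [mul_inv_cancel, h.one, h.inv] at this
  linarith

theorem comp (h : ConjSeminorm N) {H : Type} [Group H] (f : H →* G) :
    ConjSeminorm (fun x => N (f x)) where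
  one := by simp [h.one]
  inv a := by simp [h.inv]
  mul a b := by simp [h.mul]
  conj a b := by simp [h.conj]

theorem comm (h : ConjSeminorm N) (a b : G) : N (a * b) = N (b * a) := by
  have := h.conj b (a * b)
  rw [← this]; congr 1; group

end ConjSeminorm

theorem BiInvariantDist.conjSeminorm {H : Type} [Group H] [MetricSpace H]
    (hH : BiInvariantDist H) : ConjSeminorm (fun x : H => dist 1 x) where
  one := dist_self _
  inv a := by
    have := (hH a 1 a⁻¹).1
    rw [mul_one, mul_inv_cancel, dist_comm] at this
    exact this.symm
  mul a b := by
    have := (hH a 1 b).1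
    rw [mul_one] at this
    rw [← this]
    exact dist_triangle _ _ _
  conj a b := by
    have h1 := (hH a⁻¹ 1 (a * b * a⁻¹)).1
    have h2 := (hH a (a⁻¹ * 1) (a⁻¹ * (a * b * a⁻¹))).2
    rw [← h1, ← h2]; congr 1 <;> group

theorem BiInvariantDist.dist_eq {H : Type} [Group H] [MetricSpace H]
    (hH : BiInvariantDist H) (a b : H) : dist a b = dist 1 (a⁻¹ * b) := by
  have := (hH a⁻¹ a b).1
  rw [← this]; simp

theorem exists_completion {Q : Type} [Group Q] {N : Q → ℝ} (hN : ConjSeminorm N) :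
    ∃ (G : Type) (_ : Group G) (_ : MetricSpace G), BiInvariantDist G ∧ CompleteSpace G ∧
      ∃ f : Q →* G, DenseRange f ∧ ∀ a, dist 1 (f a) = N a := by
  letI : PseudoMetricSpace (Additive Q) :=
    { dist := fun a b => N ((Additive.toMul a)⁻¹ * Additive.toMul b)
      dist_self := fun a => by simp [hN.one]
      dist_comm := fun a b => by
        rw [← hN.inv]; congr 1; group
      dist_triangle := fun a b c => by
        refine le_trans (le_of_eq ?_) (hN.mul _ _); congr 1; group }
  have hd : ∀ a b : Additive Q, dist a b = N ((Additive.toMul a)⁻¹ * Additive.toMul b) := fun _ _ => rfl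
  have hl : ∀ g a b : Additive Q, dist (g + a) (g + b) = dist a b := fun g a b => by
    rw [hd, hd]; congr 1; simp [mul_assoc]
  have hr : ∀ g a b : Additive Q, dist (a + g) (b + g) = dist a b := fun g a b => by
    rw [hd, hd, ← hN.conj (Additive.toMul g)]; congr 1; simp [mul_assoc]
  have hneg : ∀ a b : Additive Q, dist (-a) (-b) = dist a b := fun a b => by
    rw [← hl a, ← hr b]; simp [dist_comm]
  have : IsUniformAddGroup (Additive Q) := by
    refine ⟨?_⟩
    rw [Metric.uniformContinuous_iff]
    intro ε hε
    refine ⟨ε / 2, by positivity, fun {p q} hpq => ?_⟩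
    rw [Prod.dist_eq, max_lt_iff] at hpq
    calc dist (p.1 - p.2) (q.1 - q.2) ≤ dist (p.1 - p.2) (q.1 - p.2)
          + dist (q.1 - p.2) (q.1 - q.2) := dist_triangle _ _ _
      _ = dist p.1 q.1 + dist p.2 q.2 := by
          rw [sub_eq_add_neg, sub_eq_add_neg, sub_eq_add_neg, hr, hl, hneg]
      _ < ε := by linarith [hpq.1, hpq.2]
  let C := UniformSpace.Completion (Additive Q)
  have hL : ∀ g a b : C, dist (g + a) (g + b) = dist a b := by
    intro g a b
    refine UniformSpace.Completion.induction_on₃ g a b ?_ ?_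
    · exact isClosed_eq (by fun_prop) (by fun_prop)
    · intro g a b
      rw [← UniformSpace.Completion.coe_add, ← UniformSpace.Completion.coe_add,
        UniformSpace.Completion.dist_eq, UniformSpace.Completion.dist_eq, hl]
  have hR : ∀ g a b : C, dist (a + g) (b + g) = dist a b := by
    intro g a b
    refine UniformSpace.Completion.induction_on₃ g a b ?_ ?_
    · exact isClosed_eq (by fun_prop) (by fun_prop)
    · intro g a b
      rw [← UniformSpace.Completion.coe_add, ← UniformSpace.Completion.coe_add,
        UniformSpace.Completion.dist_eq, UniformSpace.Completion.dist_eq, hr]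
  refine ⟨Multiplicative C, inferInstance, inferInstance, ?_, ?_, ?_⟩
  · intro g x y
    exact ⟨hL (Multiplicative.toAdd g) (Multiplicative.toAdd x) (Multiplicative.toAdd y),
      hR (Multiplicative.toAdd g) (Multiplicative.toAdd x) (Multiplicative.toAdd y)⟩
  · exact (inferInstance : CompleteSpace C)
  · let f : Q →* Multiplicative C :=
      { toFun := fun a => Multiplicative.ofAdd (((Additive.ofMul a : Additive Q) : C))
        map_one' := by
          rw [ofMul_one, UniformSpace.Completion.coe_zero]; rfl
        map_mul' := fun a b => by
          rw [ofMul_mul, UniformSpace.Completion.coe_add]; rfl }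
    refine ⟨f, ?_, ?_⟩
    · have := UniformSpace.Completion.denseRange_coe (α := Additive Q)
      intro x
      exact this (Multiplicative.toAdd x)
    · intro a
      have h0 : dist (1 : Multiplicative C) (f a) = dist (((0 : Additive Q) : C)) ((Additive.ofMul a : Additive Q) : C) := rfl
      rw [h0, UniformSpace.Completion.dist_eq, hd]; simp

theorem exists_extension {D H G : Type} [Group D] [Group H] [MetricSpace H] [Group G]
    [MetricSpace G] [CompleteSpace G] (hH : BiInvariantDist H) (hG : BiInvariantDist G)
    (p : D →* H) (hp : DenseRange p) (f : D →* G) (hf : ∀ a, dist 1 (f a) = dist 1 (p a)) :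
    ∃ F : H →* G, Function.Injective F ∧ Isometry F := by
  have hfd : ∀ a b, dist (f a) (f b) = dist (p a) (p b) := fun a b => by
    rw [hG.dist_eq, hH.dist_eq, ← map_inv, ← map_inv, ← map_mul, ← map_mul, hf]
  letI : PseudoMetricSpace D := PseudoMetricSpace.induced p inferInstance
  have hpi : Isometry p := Isometry.of_dist_eq fun a b => rfl
  have hfi : Isometry f := Isometry.of_dist_eq fun a b => hfd a b
  have hui : IsUniformInducing p := hpi.isUniformInducing
  have hdi := hui.isDenseInducing hp
  let F : H → G := hdi.extend f
  have hFc : Continuous F :=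
    (uniformContinuous_uniformly_extend hui hp hfi.uniformContinuous).continuous
  have hFp : ∀ a, F (p a) = f a := fun a =>
    uniformly_extend_of_ind hui hp hfi.uniformContinuous a
  have hFd : ∀ a b, dist (F a) (F b) = dist a b := by
    intro a b
    refine hp.induction_on₂ (p := fun a b => dist (F a) (F b) = dist a b) ?_ ?_ a b
    · exact isClosed_eq (by fun_prop) (by fun_prop)
    · intro a b; rw [hFp, hFp]; exact hfd a b
  have hcm : ∀ (K : Type) [Group K] [MetricSpace K], BiInvariantDist K →
      Continuous fun q : K × K => q.1 * q.2 := by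
    intro K _ _ hK
    rw [Metric.continuous_iff]
    intro b ε hε
    refine ⟨ε / 2, by positivity, fun q hpq => ?_⟩
    rw [Prod.dist_eq, max_lt_iff] at hpq
    calc dist (q.1 * q.2) (b.1 * b.2) ≤ dist (q.1 * q.2) (b.1 * q.2)
          + dist (b.1 * q.2) (b.1 * b.2) := dist_triangle _ _ _
      _ = dist q.1 b.1 + dist q.2 b.2 := by rw [(hK _ _ _).1, (hK _ _ _).2]
      _ < ε := by linarith [hpq.1, hpq.2]
  have hFm : ∀ a b, F (a * b) = F a * F b := by
    intro a b
    refine hp.induction_on₂ (p := fun a b => F (a * b) = F a * F b) ?_ ?_ a b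
    · refine isClosed_eq (hFc.comp (hcm H hH)) ?_
      exact (hcm G hG).comp ((hFc.comp continuous_fst).prodMk (hFc.comp continuous_snd))
    · intro a b; rw [hFp, hFp, ← map_mul, hFp, map_mul]
  refine ⟨MonoidHom.mk' F hFm, ?_, ?_⟩
  · exact (Isometry.of_dist_eq hFd).injective
  · exact Isometry.of_dist_eq hFd

open Cardinal in
theorem exists_base : ∃ (G : Type) (_ : Group G) (N : G → ℝ), ConjSeminorm N ∧
    #G ≤ 2 ^ ℵ₀ ∧
    ∀ (D : Type) (_ : Group D) (M : D → ℝ), ConjSeminorm M → ∀ s : Set D, s.Countable →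
      s.Nonempty → ∃ e : D → G, (∀ h ∈ s, N (e h) = M h) ∧
        ∀ g ∈ s, ∀ h ∈ s, g * h ∈ s → N ((e (g * h))⁻¹ * (e g * e h)) = 0 := by
  classical
  let V := {ν : FreeGroup ℕ → ℝ // ConjSeminorm ν}
  let pr : V → FreeGroup (V × ℕ) →* FreeGroup ℕ := fun ν =>
    FreeGroup.lift fun p => if p.1 = ν then FreeGroup.of p.2 else 1
  have hb : ∀ w, BddAbove (Set.range fun ν : V => ν.1 (pr ν w)) := by
    intro w
    induction w using FreeGroup.induction_on with
    | C1 => exact ⟨0, by rintro _ ⟨ν, rfl⟩; simp [ν.2.one]⟩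
    | of p =>
      refine ⟨max 0 (p.1.1 (FreeGroup.of p.2)), ?_⟩
      rintro _ ⟨ν, rfl⟩
      by_cases h : p.1 = ν
      · subst h; simp [pr]
      · simp [pr, h, ν.2.one]
    | inv_of p ih =>
      obtain ⟨c, hc⟩ := ih
      refine ⟨c, ?_⟩
      rintro _ ⟨ν, rfl⟩
      have := hc ⟨ν, rfl⟩
      simpa [ν.2.inv] using this
    | mul x y hx hy =>
      obtain ⟨c, hc⟩ := hx
      obtain ⟨c', hc'⟩ := hy
      refine ⟨c + c', ?_⟩
      rintro _ ⟨ν, rfl⟩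
      have h1 := hc ⟨ν, rfl⟩
      have h2 := hc' ⟨ν, rfl⟩
      have := ν.2.mul (pr ν x) (pr ν y)
      simp only [map_mul] at *
      linarith
  have hne : Nonempty V := ⟨⟨fun _ => 0, by constructor <;> simp⟩⟩
  let N : FreeGroup (V × ℕ) → ℝ := fun w => ⨆ ν : V, ν.1 (pr ν w)
  have hN : ConjSeminorm N := by
    constructor
    · simp only [N, map_one]
      have : ∀ ν : V, ν.1 1 = 0 := fun ν => ν.2.one
      simp [this]
    · intro a
      have : ∀ ν : V, ν.1 (pr ν a⁻¹) = ν.1 (pr ν a) := fun ν => by rw [map_inv, ν.2.inv]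
      simp only [N, this]
    · intro a b
      refine ciSup_le fun ν => ?_
      have h1 : ν.1 (pr ν a) ≤ N a := le_ciSup (hb a) ν
      have h2 : ν.1 (pr ν b) ≤ N b := le_ciSup (hb b) ν
      have := ν.2.mul (pr ν a) (pr ν b)
      rw [map_mul]; linarith
    · intro a b
      have : ∀ ν : V, ν.1 (pr ν (a * b * a⁻¹)) = ν.1 (pr ν b) := fun ν => by
        rw [map_mul, map_mul, map_inv, ν.2.conj]
      simp only [N, this]
  refine ⟨FreeGroup (V × ℕ), inferInstance, N, hN, ?_, ?_⟩
  · rw [Cardinal.mk_freeGroup]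
    have hV : #V ≤ 2 ^ ℵ₀ := by
      refine (Cardinal.mk_subtype_le _).trans ?_
      rw [← Cardinal.power_def, Cardinal.mk_real, Cardinal.mk_freeGroup]
      simp
    refine max_le ?_ (Cardinal.cantor _).le
    rw [Cardinal.mk_prod]
    simp only [Cardinal.lift_id, Cardinal.mk_nat]
    refine (mul_le_mul' hV (Cardinal.cantor _).le).trans ?_
    rw [← Cardinal.power_add]; simp
  · intro D _ M hM s hs hsn
    obtain ⟨t, rfl⟩ := hs.exists_eq_range hsn
    let ν : V := ⟨fun w => M (FreeGroup.lift t w), hM.comp _⟩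
    let j : FreeGroup ℕ →* FreeGroup (V × ℕ) := FreeGroup.map fun n => (ν, n)
    have hj1 : ∀ w, pr ν (j w) = w := by
      intro w
      have : (pr ν).comp j = MonoidHom.id _ := by ext n; simp [pr, j]
      exact DFunLike.congr_fun this w
    have hj2 : ∀ ν', ν' ≠ ν → ∀ w, pr ν' (j w) = 1 := by
      intro ν' hν w
      have : (pr ν').comp j = 1 := by ext n; simp [pr, j, hν.symm]
      exact DFunLike.congr_fun this w
    have hNj : ∀ w, N (j w) = M (FreeGroup.lift t w) := by
      intro w
      apply le_antisymm
      · refine ciSup_le fun ν' => ?_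
        by_cases h : ν' = ν
        · subst h; rw [hj1]
        · rw [hj2 _ h, ν'.2.one]; exact hM.nonneg _
      · have := le_ciSup (hb (j w)) ν
        rw [hj1] at this
        exact this
    have hch : ∀ h : D, ∃ n : ℕ, h ∈ Set.range t → t n = h := by
      intro h
      by_cases hh : h ∈ Set.range t
      · obtain ⟨n, hn⟩ := hh; exact ⟨n, fun _ => hn⟩
      · exact ⟨0, fun h => absurd h hh⟩
    choose k hk using hch
    refine ⟨fun h => j (FreeGroup.of (k h)), ?_, ?_⟩
    · intro h hh
      rw [hNj, FreeGroup.lift_apply_of, hk h hh]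
    · intro g hg h hh hgh
      rw [← map_mul, ← map_inv, ← map_mul, hNj]
      simp [hk g hg, hk h hh, hk _ hgh, hM.one]

theorem limsup_conjSeminorm {X G : Type} [Group G] {N : G → ℝ} (hN : ConjSeminorm N)
    (W : Filter X) [W.NeBot] {Q : Type} [Group Q] (ev : Q →* (X → G))
    (hQ : ∀ w, ∃ c : ℝ, ∀ᶠ x in W, N (ev w x) ≤ c) :
    ConjSeminorm (fun w : Q => sInf {c : ℝ | ∀ᶠ x in W, N (ev w x) ≤ c}) := by
  have hb : ∀ w : Q, BddBelow {c : ℝ | ∀ᶠ x in W, N (ev w x) ≤ c} := by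
    intro w
    refine ⟨0, fun c hc => ?_⟩
    obtain ⟨x, hx⟩ := Filter.Eventually.exists hc
    exact (hN.nonneg _).trans hx
  constructor
  · apply le_antisymm
    · refine csInf_le (hb 1) ?_
      simp [hN.one]
    · refine le_csInf (hQ 1) fun c hc => ?_
      obtain ⟨x, hx⟩ := Filter.Eventually.exists hc
      exact (hN.nonneg _).trans hx
  · intro a; simp [hN.inv]
  · intro a b
    refine le_of_forall_pos_le_add fun ε hε => ?_
    have hne : ∀ w : Q, {c : ℝ | ∀ᶠ x in W, N (ev w x) ≤ c}.Nonempty := hQ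
    obtain ⟨c, hc, hc'⟩ := exists_lt_of_csInf_lt (hne a) (lt_add_of_pos_right _ (half_pos hε))
    obtain ⟨d, hd, hd'⟩ := exists_lt_of_csInf_lt (hne b) (lt_add_of_pos_right _ (half_pos hε))
    have : sInf {c : ℝ | ∀ᶠ x in W, N (ev (a * b) x) ≤ c} ≤ c + d := by
      refine csInf_le (hb _) ?_
      filter_upwards [hc, hd] with x h1 h2
      rw [map_mul]
      exact (hN.mul _ _).trans (add_le_add h1 h2)
    linarith
  · intro a b; simp [hN.conj]

theorem sInf_eq_of_tendsto {X : Type} {W : Filter X} [W.NeBot] {u : X → ℝ} {a : ℝ}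
    (h : ∀ ε > 0, ∀ᶠ x in W, |u x - a| ≤ ε) : sInf {c : ℝ | ∀ᶠ x in W, u x ≤ c} = a := by
  have hlow : ∀ c ∈ {c : ℝ | ∀ᶠ x in W, u x ≤ c}, a ≤ c := by
    intro c hc
    refine le_of_forall_pos_le_add fun ε hε => ?_
    obtain ⟨x, h1, h2⟩ := (Filter.Eventually.and hc (h ε hε)).exists
    have := abs_le.1 h2
    linarith
  have hmem : ∀ ε > 0, a + ε ∈ {c : ℝ | ∀ᶠ x in W, u x ≤ c} := by
    intro ε hε
    filter_upwards [h ε hε] with x hx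
    have := abs_le.1 hx
    linarith
  apply le_antisymm
  · exact le_of_forall_pos_le_add fun ε hε => csInf_le ⟨a, hlow⟩ (hmem ε hε)
  · exact le_csInf ⟨_, hmem 1 one_pos⟩ hlow

section Trees

variable {J : Type} [LinearOrder J]

/-- Index sets of the iterated reduced power. -/
abbrev TIdx (β : J) : Type := Finset (Set.Iic β × ℕ)

/-- The base space of the iterated reduced power. -/
abbrev TSpace (J : Type) [LinearOrder J] : Type := ∀ β : J, TIdx β

/-- The basic big sets. -/
inductive Big : J → Set (TSpace J) → Prop
  | univ (β : J) : Big β Set.univ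
  | node (β : J) (i0 : TIdx β) (D : TIdx β → Set (TSpace J)) (γ : TIdx β → J)
      (hγ : ∀ i, i0 ≤ i → γ i < β) (h : ∀ i, i0 ≤ i → Big (γ i) (D i)) :
      Big β {x | i0 ≤ x β ∧ x ∈ D (x β)}

theorem Big.exists_mem {β : J} {D : Set (TSpace J)} (h : Big β D) :
    ∀ x : TSpace J, ∃ y ∈ D, ∀ δ, β < δ → y δ = x δ := by
  classical
  induction h with
  | univ β => exact fun x => ⟨x, trivial, fun _ _ => rfl⟩
  | node β i0 D γ hγ h ih =>
    intro x
    obtain ⟨y, hy, hyx⟩ := ih i0 le_rfl (Function.update x β i0)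
    have hyβ : y β = i0 := by
      rw [hyx β (hγ i0 le_rfl)]; simp
    refine ⟨y, ⟨hyβ.ge, ?_⟩, ?_⟩
    · rw [hyβ]; exact hy
    · intro δ hδ
      rw [hyx δ ((hγ i0 le_rfl).trans hδ)]
      exact Function.update_of_ne hδ.ne' _ _

theorem Big.inter [WellFoundedLT J] (m : J) : ∀ β ≤ m, ∀ β' ≤ m, ∀ D D' : Set (TSpace J),
    Big β D → Big β' D' → ∃ γ ≤ max β β', ∃ E ⊆ D ∩ D', Big γ E := by
  classical
  induction m using WellFoundedLT.induction with
  | ind m ih =>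
  intro β hβ β' hβ' D D' hD hD'
  have hne : Nonempty J := ⟨β⟩
  cases hD with
  | univ => exact ⟨β', le_max_right _ _, D', by simp, hD'⟩
  | node _ i0 D γ hγ h =>
  cases hD' with
  | univ => exact ⟨β, le_max_left _ _, _, by simp, Big.node β i0 D γ hγ h⟩
  | node _ i0' D' γ' hγ' h' =>
  rcases lt_trichotomy β β' with hlt | heq | hlt
  · have : ∀ i, i0' ≤ i → ∃ δ < β', ∃ E ⊆ {x | i0 ≤ x β ∧ x ∈ D (x β)} ∩ D' i, Big δ E := by
      intro i hi
      have hmx : max β (γ' i) < β' := max_lt hlt (hγ' i hi)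
      obtain ⟨δ, hδ, E, hE, hB⟩ := ih (max β (γ' i)) (hmx.trans_le hβ') β (le_max_left _ _)
        (γ' i) (le_max_right _ _) _ _ (Big.node β i0 D γ hγ h) (h' i hi)
      exact ⟨δ, hδ.trans_lt hmx, E, hE, hB⟩
    choose! δ hδ E hE hB using this
    refine ⟨β', le_max_right _ _, _, ?_, Big.node β' i0' E δ hδ hB⟩
    rintro x ⟨hx1, hx2⟩
    have := hE _ hx1 hx2
    exact ⟨this.1, hx1, this.2⟩
  · subst heq
    have : ∀ i, i0 ⊔ i0' ≤ i → ∃ δ < β, ∃ E ⊆ D i ∩ D' i, Big δ E := by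
      intro i hi
      have hi1 := le_sup_left.trans hi
      have hi2 := le_sup_right.trans hi
      have hmx : max (γ i) (γ' i) < β := max_lt (hγ i hi1) (hγ' i hi2)
      obtain ⟨δ, hδ, E, hE, hB⟩ := ih (max (γ i) (γ' i)) (hmx.trans_le hβ) (γ i)
        (le_max_left _ _) (γ' i) (le_max_right _ _) _ _ (h i hi1) (h' i hi2)
      exact ⟨δ, hδ.trans_lt hmx, E, hE, hB⟩
    choose! δ hδ E hE hB using this
    refine ⟨β, le_max_left _ _, _, ?_, Big.node β (i0 ⊔ i0') E δ hδ hB⟩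
    rintro x ⟨hx1, hx2⟩
    have := hE _ hx1 hx2
    exact ⟨⟨le_sup_left.trans hx1, this.1⟩, le_sup_right.trans hx1, this.2⟩
  · have : ∀ i, i0 ≤ i → ∃ δ < β, ∃ E ⊆ D i ∩ {x | i0' ≤ x β' ∧ x ∈ D' (x β')}, Big δ E := by
      intro i hi
      have hmx : max (γ i) β' < β := max_lt (hγ i hi) hlt
      obtain ⟨δ, hδ, E, hE, hB⟩ := ih (max (γ i) β') (hmx.trans_le hβ) (γ i) (le_max_left _ _)
        β' (le_max_right _ _) _ _ (h i hi) (Big.node β' i0' D' γ' hγ' h')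
      exact ⟨δ, hδ.trans_lt hmx, E, hE, hB⟩
    choose! δ hδ E hE hB using this
    refine ⟨β, le_max_left _ _, _, ?_, Big.node β i0 E δ hδ hB⟩
    rintro x ⟨hx1, hx2⟩
    have := hE _ hx1 hx2
    exact ⟨⟨hx1, this.1⟩, this.2⟩

/-- The filter of big sets. -/
def bigFilter (J : Type) [LinearOrder J] [WellFoundedLT J] [OrderBot J] :
    Filter (TSpace J) where
  sets := {B | ∃ β D, Big β D ∧ D ⊆ B}
  univ_sets := ⟨⊥, Set.univ, Big.univ _, subset_rfl⟩
  sets_of_superset := by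
    rintro B B' ⟨β, D, hD, h⟩ hB
    exact ⟨β, D, hD, h.trans hB⟩
  inter_sets := by
    rintro B B' ⟨β, D, hD, h⟩ ⟨β', D', hD', h'⟩
    obtain ⟨γ, -, E, hE, hB⟩ := Big.inter (max β β') β (le_max_left _ _) β' (le_max_right _ _)
      D D' hD hD'
    exact ⟨γ, E, hB, hE.trans (Set.inter_subset_inter h h')⟩

theorem mem_bigFilter [WellFoundedLT J] [OrderBot J] {B : Set (TSpace J)} :
    B ∈ bigFilter J ↔ ∃ β D, Big β D ∧ D ⊆ B := Iff.rfl

instance [WellFoundedLT J] [OrderBot J] : (bigFilter J).NeBot := by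
  refine ⟨fun h => ?_⟩
  have : (∅ : Set (TSpace J)) ∈ bigFilter J := by rw [h]; trivial
  obtain ⟨β, D, hD, h⟩ := mem_bigFilter.1 this
  obtain ⟨y, hy, -⟩ := hD.exists_mem (fun _ => ∅)
  exact h hy

/-- Superset of a big set, at level at most `m`. -/
def IsBig (m : J) (B : Set (TSpace J)) : Prop := ∃ β ≤ m, ∃ D, Big β D ∧ D ⊆ B

theorem IsBig.mem [WellFoundedLT J] [OrderBot J] {m : J} {B : Set (TSpace J)} (h : IsBig m B) :
    B ∈ bigFilter J := by
  obtain ⟨β, -, D, hD, h⟩ := h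
  exact ⟨β, D, hD, h⟩

theorem IsBig.node {β : J} {B : Set (TSpace J)}
    (h : ∀ᶠ i : TIdx β in Filter.atTop, ∃ γ < β, IsBig γ {x | x β = i → x ∈ B}) : IsBig β B := by
  classical
  obtain ⟨i0, hi0⟩ := Filter.eventually_atTop.1 h
  have : ∀ i, i0 ≤ i → ∃ γ < β, ∃ D, Big γ D ∧ D ⊆ {x | x β = i → x ∈ B} := by
    intro i hi
    obtain ⟨γ, hγ, γ', hγ', D, hD, hDB⟩ := hi0 i hi
    exact ⟨γ', hγ'.trans_lt hγ, D, hD, hDB⟩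
  have hne : Nonempty J := ⟨β⟩
  choose! γ hγ D hD hDB using this
  refine ⟨β, le_rfl, _, Big.node β i0 D γ hγ hD, ?_⟩
  rintro x ⟨hx1, hx2⟩
  exact hDB _ hx1 hx2 rfl

/-- Functions given by trees. -/
inductive STree {G : Type} : J → (TSpace J → G) → Prop
  | const (β : J) (g : G) : STree β (fun _ => g)
  | node (β : J) (f : TIdx β → TSpace J → G) (γ : TIdx β → J) (hγ : ∀ i, γ i < β)
      (h : ∀ i, STree (γ i) (f i)) : STree β (fun x => f (x β) x)

open Cardinal in
theorem mk_sTree_le [WellFoundedLT J] {G : Type} (hG : #G ≤ 2 ^ ℵ₀) (β : J) :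
    #{F : TSpace J → G | STree β F} ≤ 2 ^ (max #(Set.Iic β) ℵ₀) := by
  induction β using WellFoundedLT.induction with
  | ind β ih =>
  set l := max #(Set.Iic β) ℵ₀ with hl
  have hl0 : ℵ₀ ≤ l := le_max_right _ _
  let U : Set (TSpace J → G) := ⋃ γ : Set.Iio β, {F | STree γ.1 F}
  have hU : #U ≤ 2 ^ l := by
    refine (Cardinal.mk_iUnion_le _).trans ?_
    have h1 : #(Set.Iio β) ≤ 2 ^ l :=
      ((Cardinal.mk_le_mk_of_subset Set.Iio_subset_Iic_self).trans (le_max_left _ _)).trans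
        (Cardinal.cantor _).le
    have h2 : (⨆ γ : Set.Iio β, #{F : TSpace J → G | STree γ.1 F}) ≤ 2 ^ l := by
      refine ciSup_le' fun γ => (ih γ.1 γ.2).trans ?_
      refine Cardinal.power_le_power_left two_ne_zero (max_le_max ?_ le_rfl)
      exact Cardinal.mk_le_mk_of_subset (Set.Iic_subset_Iic.2 (le_of_lt γ.2))
    refine (mul_le_mul' h1 h2).trans ?_
    rw [← Cardinal.power_add, Cardinal.add_eq_self hl0]
  have hI : #(TIdx β) ≤ l := by
    rw [Cardinal.mk_finset_of_infinite, Cardinal.mk_prod]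
    simp only [Cardinal.lift_id, Cardinal.mk_nat]
    refine (Cardinal.mul_le_max _ _).trans ?_
    simp [hl]
  let φ : G ⊕ (TIdx β → U) → (TSpace J → G) := fun z =>
    Sum.elim (fun g _ => g) (fun f x => (f (x β)).1 x) z
  have hφ : {F : TSpace J → G | STree β F} ⊆ Set.range φ := by
    intro F hF
    have hF' : STree β F := hF
    cases hF' with
    | const _ g => exact ⟨Sum.inl g, rfl⟩
    | node _ f γ hγ h =>
      exact ⟨Sum.inr fun i => ⟨f i, Set.mem_iUnion.2 ⟨⟨γ i, hγ i⟩, h i⟩⟩, rfl⟩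
  refine (Cardinal.mk_le_mk_of_subset hφ).trans (Cardinal.mk_range_le.trans ?_)
  rw [Cardinal.mk_sum, Cardinal.lift_id, Cardinal.lift_id, ← Cardinal.power_def]
  have h3 : #U ^ #(TIdx β) ≤ 2 ^ l := by
    refine (Cardinal.power_le_power_right hU).trans ?_
    rw [← Cardinal.power_mul]
    refine Cardinal.power_le_power_left two_ne_zero ?_
    exact (mul_le_mul' le_rfl hI).trans (Cardinal.mul_eq_self hl0).le
  have h4 : #G ≤ 2 ^ l := hG.trans (Cardinal.power_le_power_left two_ne_zero hl0)
  refine (add_le_add h4 h3).trans ?_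
  rw [Cardinal.add_eq_self (hl0.trans (Cardinal.cantor _).le)]

end Trees

/-- Finite patterns. -/
abbrev Pat (n : ℕ) : Type :=
  Finset (Fin n) × Finset (Fin n × Fin n × Fin n) × (Fin n → ℚ) × ℕ

/-- A tuple realizes a pattern. -/
def Realizes {D : Type} [Group D] (N : D → ℝ) {n : ℕ} (p : Pat n) (e : Fin n → D) : Prop :=
  (∀ t ∈ p.2.1, e t.1 * e t.2.1 = e t.2.2) ∧
    ∀ i, |N (e i) - (p.2.2.1 i : ℝ)| < 1 / ((p.2.2.2 : ℝ) + 1)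

open Classical in
/-- Skolem function of a pattern. -/
noncomputable def skf {D : Type} [Group D] (N : D → ℝ) {n : ℕ} (p : Pat n) (c : Fin n → D) :
    Fin n → D :=
  if h : ∃ e, Realizes N p e ∧ ∀ i ∈ p.1, e i = c i then h.choose else c

theorem skf_spec {D : Type} [Group D] (N : D → ℝ) {n : ℕ} (p : Pat n) (c : Fin n → D)
    (h : ∃ e, Realizes N p e ∧ ∀ i ∈ p.1, e i = c i) :
    Realizes N p (skf N p c) ∧ ∀ i ∈ p.1, skf N p c i = c i := by
  rw [skf, dif_pos h]
  exact h.choose_spec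

/-- The Skolem language. -/
def skL : FirstOrder.Language.{0, 0} := ⟨fun n => Option (Pat n × Fin n), fun _ => Empty⟩

instance : Countable (Σ n, skL.Functions n) := by
  have : ∀ n, Countable (skL.Functions n) := fun n =>
    inferInstanceAs (Countable (Option (Pat n × Fin n)))
  infer_instance

open Cardinal in
theorem exists_rank {J : Type} [LinearOrder J] [WellFoundedLT J] [OrderBot J] {D : Type}
    [Group D] (N : D → ℝ) (d : J → D) (hd : Function.Surjective d) :
    ∃ r : D → J, r 1 = ⊥ ∧ (∀ β, #{h | r h ≤ β} ≤ max #(Set.Iic β) ℵ₀) ∧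
      ∀ β ≠ ⊥, ∀ (E : Finset D) (n : ℕ), ∃ φ : D → D, (∀ h, r (φ h) < β) ∧
        (∀ h ∈ E, r h < β → φ h = h) ∧
        (∀ g ∈ E, ∀ h ∈ E, g * h ∈ E → φ (g * h) = φ g * φ h) ∧
        ∀ h ∈ E, |N (φ h) - N h| ≤ 1 / ((n : ℝ) + 1) := by
  classical
  letI : skL.Structure D :=
    { funMap := fun {n} f c => match f with
        | none => 1
        | some (p, i) => skf N p c i
      RelMap := fun {n} R => nomatch R }
  let K : J → skL.Substructure D := fun β => FirstOrder.Language.Substructure.closure skL (d '' Set.Iic β)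
  have hmono : ∀ β γ, β ≤ γ → K β ≤ K γ := fun β γ h =>
    FirstOrder.Language.Substructure.closure_mono (Set.image_mono (Set.Iic_subset_Iic.2 h))
  have hex : ∀ h : D, ∃ β, h ∈ K β := fun h => by
    obtain ⟨β, rfl⟩ := hd h
    exact ⟨β, FirstOrder.Language.Substructure.subset_closure ⟨β, Set.mem_Iic.2 le_rfl, rfl⟩⟩
  let r : D → J := fun h => WellFounded.min (wellFounded_lt (α := J)) {β | h ∈ K β} (hex h)
  have hr : ∀ h β, r h ≤ β ↔ h ∈ K β := by
    intro h β
    constructor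
    · intro hle
      exact hmono _ _ hle (WellFounded.min_mem (wellFounded_lt (α := J)) {β | h ∈ K β} (hex h))
    · intro hm
      exact WellFounded.min_le (wellFounded_lt (α := J)) (s := {β | h ∈ K β}) hm
  have hone : ∀ β, (1 : D) ∈ K β := fun β =>
    (K β).fun_mem (n := 0) (none : Option (Pat 0 × Fin 0)) (fun i => i.elim0) (fun i => i.elim0)
  have hsk : ∀ β n (p : Pat n) (c : Fin n → D), (∀ i, c i ∈ K β) → ∀ i, skf N p c i ∈ K β :=
    fun β n p c hc i => (K β).fun_mem (n := n) (some (p, i) : Option (Pat n × Fin n)) c hc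
  have hr1 : r 1 = ⊥ := le_bot_iff.1 ((hr _ _).2 (hone _))
  refine ⟨r, hr1, ?_, ?_⟩
  · intro β
    have h1 : {h | r h ≤ β} = (K β : Set D) := by ext h; exact hr h β
    rw [h1]
    have h2 := FirstOrder.Language.Substructure.lift_card_closure_le (L := skL)
      (s := d '' Set.Iic β)
    simp only [Cardinal.lift_id] at h2
    refine h2.trans (max_le (le_max_right _ _) ?_)
    refine (Cardinal.add_le_max _ _).trans (max_le (max_le_max Cardinal.mk_image_le ?_)
      (le_max_right _ _))
    exact Cardinal.mk_le_aleph0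
  · intro β hβ E n
    let e0 : Fin E.card → D := fun i => (E.equivFin.symm i).1
    have hq : ∀ i, ∃ q : ℚ, |N (e0 i) - (q : ℝ)| < 1 / (((2 * n + 1 : ℕ) : ℝ) + 1) := by
      intro i
      obtain ⟨q, h1, h2⟩ := exists_rat_btwn
        (show N (e0 i) < N (e0 i) + 1 / (((2 * n + 1 : ℕ) : ℝ) + 1) by
          have : (0 : ℝ) < 1 / (((2 * n + 1 : ℕ) : ℝ) + 1) := by positivity
          linarith)
      refine ⟨q, ?_⟩
      rw [abs_lt]; constructor <;> linarith
    choose q hq using hq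
    let p : Pat E.card := (Finset.univ.filter fun i => r (e0 i) < β,
      Finset.univ.filter fun t => e0 t.1 * e0 t.2.1 = e0 t.2.2, q, 2 * n + 1)
    let c : Fin E.card → D := fun i => if r (e0 i) < β then e0 i else 1
    have hbot : ⊥ < β := bot_lt_iff_ne_bot.2 hβ
    have hc : ∀ i, r (c i) < β := by
      intro i
      by_cases h : r (e0 i) < β
      · simp only [c, if_pos h]; exact h
      · simp only [c, if_neg h, hr1]; exact hbot
    obtain ⟨hs1, hs2⟩ := skf_spec N p c ⟨e0, ⟨by simp [p], by simpa [p] using hq⟩, by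
      intro i hi
      simp only [p, Finset.mem_filter, Finset.mem_univ, true_and] at hi
      simp only [c, if_pos hi]⟩
    set e := skf N p c with he
    have her : ∀ i, r (e i) < β := by
      intro i
      have h1 : Finset.univ.sup (fun i => r (c i)) < β :=
        (Finset.sup_lt_iff hbot).2 fun i _ => hc i
      refine lt_of_le_of_lt ((hr _ _).2 (hsk _ _ p c (fun j => ?_) i)) h1
      exact (hr _ _).1 (Finset.le_sup (f := fun i => r (c i)) (Finset.mem_univ j))
    have hidx : ∀ h (hh : h ∈ E), e0 (E.equivFin ⟨h, hh⟩) = h := fun h hh => by simp [e0]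
    refine ⟨fun h => if hh : h ∈ E then e (E.equivFin ⟨h, hh⟩) else 1, ?_, ?_, ?_, ?_⟩
    · intro h
      by_cases hh : h ∈ E
      · simp only [dif_pos hh]; exact her _
      · simp only [dif_neg hh, hr1]; exact hbot
    · intro h hh hlt
      simp only [dif_pos hh]
      rw [hs2]
      · simp only [c, hidx, if_pos hlt]
      · simp only [p, Finset.mem_filter, Finset.mem_univ, true_and, hidx]; exact hlt
    · intro g hg h hh hgh
      simp only [dif_pos hg, dif_pos hh, dif_pos hgh]
      refine (hs1.1 (E.equivFin ⟨g, hg⟩, E.equivFin ⟨h, hh⟩, E.equivFin ⟨_, hgh⟩) ?_).symm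
      simp only [p, Finset.mem_filter, Finset.mem_univ, true_and, hidx]
    · intro h hh
      simp only [dif_pos hh]
      have h1 := hs1.2 (E.equivFin ⟨h, hh⟩)
      have h2 := hq (E.equivFin ⟨h, hh⟩)
      rw [hidx] at h2
      have h3 : (1 : ℝ) / (n + 1) = 2 * (1 / (((2 * n + 1 : ℕ) : ℝ) + 1)) := by
        push_cast; field_simp; ring
      rw [h3]
      change |N (e _) - (q _ : ℝ)| < 1 / (((2 * n + 1 : ℕ) : ℝ) + 1) at h1
      rw [abs_lt] at h1 h2
      rw [abs_le]; constructor <;> linarith [h1.1, h1.2, h2.1, h2.2]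

open Cardinal Filter in
theorem exists_approx {J : Type} [LinearOrder J] [WellFoundedLT J] [OrderBot J] {D : Type}
    [Group D] (N : D → ℝ) (d : J → D) (hd : Function.Surjective d) :
    ∃ (r : D → J) (φ : ∀ β : J, TIdx β → D → D), r 1 = ⊥ ∧ {h | r h ≤ ⊥}.Countable ∧
      ∀ β ≠ ⊥, (∀ i h, r (φ β i h) < β) ∧
        (∀ h, r h < β → ∀ᶠ i in atTop, φ β i h = h) ∧
        (∀ g h, r g ≤ β → r h ≤ β → r (g * h) ≤ β →
          ∀ᶠ i in atTop, φ β i (g * h) = φ β i g * φ β i h) ∧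
        ∀ h, r h ≤ β → ∀ ε > 0, ∀ᶠ i in atTop, |N (φ β i h) - N h| ≤ ε := by
  classical
  obtain ⟨r, hr1, hrc, H⟩ := exists_rank N d hd
  have hsur : ∀ β : J, ∃ s : Set.Iic β × ℕ → D, ∀ h, r h ≤ β → ∃ l, s l = h := by
    intro β
    have : #{h | r h ≤ β} ≤ #(Set.Iic β × ℕ) := by
      refine (hrc β).trans ?_
      rw [Cardinal.mk_prod]
      simp only [Cardinal.lift_id, Cardinal.mk_nat]
      have : #(Set.Iic β) ≠ 0 := Cardinal.mk_ne_zero_iff.2 ⟨⟨β, Set.mem_Iic.2 le_rfl⟩⟩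
      exact max_le (Cardinal.le_mul_right Cardinal.aleph0_ne_zero) (Cardinal.le_mul_left this)
    obtain ⟨f⟩ := Cardinal.le_def _ _ |>.1 this
    have hne : Nonempty {h | r h ≤ β} := ⟨⟨1, by simp [hr1]⟩⟩
    refine ⟨fun l => (Function.invFun f l).1, fun h hh => ⟨f ⟨h, hh⟩, ?_⟩⟩
    exact congrArg Subtype.val (Function.leftInverse_invFun f.injective ⟨h, hh⟩)
  choose s hs using hsur
  have H' : ∀ (β : J) (i : TIdx β), ∃ φ : D → D, β ≠ ⊥ → (∀ h, r (φ h) < β) ∧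
        (∀ h ∈ i.image (s β), r h < β → φ h = h) ∧
        (∀ g ∈ i.image (s β), ∀ h ∈ i.image (s β), g * h ∈ i.image (s β) →
          φ (g * h) = φ g * φ h) ∧
        ∀ h ∈ i.image (s β), |N (φ h) - N h| ≤ 1 / ((i.card : ℝ) + 1) := by
    intro β i
    by_cases hβ : β = ⊥
    · exact ⟨id, fun h => absurd hβ h⟩
    · obtain ⟨φ, hφ⟩ := H β hβ (i.image (s β)) i.card
      exact ⟨φ, fun _ => hφ⟩
  choose φ hφ using H'
  have hev : ∀ β h, r h ≤ β → ∀ᶠ i : TIdx β in atTop, h ∈ i.image (s β) := by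
    intro β h hh
    obtain ⟨l, rfl⟩ := hs β h hh
    filter_upwards [eventually_ge_atTop ({l} : TIdx β)] with i hi
    exact Finset.mem_image_of_mem _ (hi (Finset.mem_singleton_self l))
  refine ⟨r, φ, hr1, ?_, fun β hβ => ⟨fun i => (hφ β i hβ).1, ?_, ?_, ?_⟩⟩
  · rw [← Cardinal.le_aleph0_iff_set_countable]
    refine (hrc ⊥).trans (max_le ?_ le_rfl)
    rw [Set.Iic_bot]; simp
  · intro h hh
    filter_upwards [hev β h hh.le] with i hi
    exact (hφ β i hβ).2.1 h hi hh
  · intro g h hg hh hgh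
    filter_upwards [hev β g hg, hev β h hh, hev β _ hgh] with i h1 h2 h3
    exact (hφ β i hβ).2.2.1 g h1 h h2 h3
  · intro h hh ε hε
    obtain ⟨n, hn⟩ := exists_nat_one_div_lt hε
    have hinf : Infinite (Set.Iic β × ℕ) := by
      have : Nonempty (Set.Iic β) := ⟨⟨β, Set.mem_Iic.2 le_rfl⟩⟩
      infer_instance
    obtain ⟨i0, hi0⟩ := Infinite.exists_subset_card_eq (Set.Iic β × ℕ) n
    filter_upwards [hev β h hh, eventually_ge_atTop i0] with i h1 h2
    refine ((hφ β i hβ).2.2.2 h h1).trans (le_trans ?_ hn.le)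
    have : n ≤ i.card := hi0 ▸ Finset.card_le_card h2
    have : (n : ℝ) ≤ i.card := by exact_mod_cast this
    gcongr

universe u

open Filter in
theorem exists_tree_map {J : Type} [LinearOrder J] [WellFoundedLT J] [OrderBot J] {D G : Type}
    [Group D] [Group G] {M : D → ℝ} {N : G → ℝ} (d : J → D) (hd : Function.Surjective d)
    (hbase : ∀ s : Set D, s.Countable →
      s.Nonempty → ∃ e : D → G, (∀ h ∈ s, N (e h) = M h) ∧
        ∀ g ∈ s, ∀ h ∈ s, g * h ∈ s → N ((e (g * h))⁻¹ * (e g * e h)) = 0) :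
    ∃ F : D → TSpace J → G, (∀ h, ∃ β, STree β (F h)) ∧
      (∀ h, ∀ ε > 0, ∀ᶠ x in bigFilter J, |N (F h x) - M h| ≤ ε) ∧
      ∀ g h, ∀ᶠ x in bigFilter J, N ((F (g * h) x)⁻¹ * (F g x * F h x)) = 0 := by
  classical
  obtain ⟨r, φ, hr1, hrc, H⟩ := exists_approx M d hd
  obtain ⟨e, he1, he2⟩ := hbase _ hrc ⟨1, hr1.le⟩
  have hF : ∃ F : D → TSpace J → G, ∀ h, F h =
      if r h = ⊥ then fun _ => e h else fun x => F (φ (r h) (x (r h)) h) x := by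
    let step : ∀ h : D, (∀ g : D, r g < r h → TSpace J → G) → TSpace J → G := fun h rec =>
      if hb : r h = ⊥ then fun _ => e h
      else fun x => rec (φ (r h) (x (r h)) h) ((H _ hb).1 _ _) x
    have wf : WellFounded (fun g h : D => r g < r h) := InvImage.wf r wellFounded_lt
    refine ⟨wf.fix step, fun h => ?_⟩
    rw [wf.fix_eq]
    by_cases hb : r h = ⊥
    · simp only [step, dif_pos hb, if_pos hb]
    · simp only [step, dif_neg hb, if_neg hb]
  obtain ⟨F, hF⟩ := hF
  have hFb : ∀ h x, r h = ⊥ → F h x = e h := by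
    intro h x hb
    rw [hF, if_pos hb]
  have hFn : ∀ β ≠ ⊥, ∀ h, r h ≤ β → ∀ᶠ i in atTop,
      ∀ x : TSpace J, x β = i → F h x = F (φ β i h) x := by
    intro β hβ h hh
    rcases hh.lt_or_eq with hlt | heq
    · filter_upwards [(H β hβ).2.1 h hlt] with i hi x hx
      rw [hi]
    · subst heq
      refine Eventually.of_forall fun i x hx => ?_
      subst hx
      conv_lhs => rw [hF, if_neg hβ]
  refine ⟨F, ?_, ?_, ?_⟩
  · intro h
    refine ⟨r h, ?_⟩
    generalize hm : r h = m
    induction m using WellFoundedLT.induction generalizing h with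
    | ind m ih =>
    rw [hF]
    by_cases hb : r h = ⊥
    · rw [if_pos hb]; exact STree.const _ _
    · rw [if_neg hb]
      subst hm
      exact STree.node (r h) (fun i x => F (φ (r h) i h) x) (fun i => r (φ (r h) i h))
        (fun i => (H _ hb).1 _ _) fun i => ih _ ((H _ hb).1 _ _) _ rfl
  · intro h ε hε
    suffices ∀ m h, r h ≤ m → ∀ ε > 0, IsBig m {x | |N (F h x) - M h| ≤ ε} from
      (this (r h) h le_rfl ε hε).mem
    intro m
    induction m using WellFoundedLT.induction with
    | ind m ih =>
    intro h hm ε hε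
    by_cases hb : m = ⊥
    · subst hb
      refine ⟨⊥, le_rfl, Set.univ, Big.univ _, fun x _ => ?_⟩
      change |N (F h x) - M h| ≤ ε
      rw [hFb h x (le_bot_iff.1 hm), he1 h hm]
      simpa using hε.le
    · apply IsBig.node
      filter_upwards [hFn m hb h hm, (H m hb).2.2.2 h hm (ε / 2) (half_pos hε)] with i h1 h2
      have hlt := (H m hb).1 i h
      refine ⟨_, hlt, ?_⟩
      obtain ⟨β, hβ, E, hE, hsub⟩ := ih _ hlt (φ m i h) le_rfl (ε / 2) (half_pos hε)
      refine ⟨β, hβ, E, hE, fun x hx hxi => ?_⟩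
      have h3 : |N (F (φ m i h) x) - M (φ m i h)| ≤ ε / 2 := hsub hx
      change |N (F h x) - M h| ≤ ε
      rw [h1 x hxi]
      have := abs_sub_le (N (F (φ m i h) x)) (M (φ m i h)) (M h)
      linarith
  · intro g h
    suffices ∀ m g h, r g ≤ m → r h ≤ m → r (g * h) ≤ m →
        IsBig m {x | N ((F (g * h) x)⁻¹ * (F g x * F h x)) = 0} from
      (this (max (max (r g) (r h)) (r (g * h))) g h
        ((le_max_left _ _).trans (le_max_left _ _)) ((le_max_right _ _).trans (le_max_left _ _))
        (le_max_right _ _)).mem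
    intro m
    induction m using WellFoundedLT.induction with
    | ind m ih =>
    intro g h hg hh hgh
    by_cases hb : m = ⊥
    · subst hb
      refine ⟨⊥, le_rfl, Set.univ, Big.univ _, fun x _ => ?_⟩
      change N _ = 0
      rw [hFb g x (le_bot_iff.1 hg), hFb h x (le_bot_iff.1 hh), hFb _ x (le_bot_iff.1 hgh)]
      exact he2 g hg h hh hgh
    · apply IsBig.node
      filter_upwards [hFn m hb h hh, hFn m hb g hg, hFn m hb _ hgh,
        (H m hb).2.2.1 g h hg hh hgh] with i h1 h2 h3 h4
      have l1 := (H m hb).1 i h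
      have l2 := (H m hb).1 i g
      have l3 := (H m hb).1 i (g * h)
      have hlt : max (max (r (φ m i g)) (r (φ m i h))) (r (φ m i (g * h))) < m :=
        max_lt (max_lt l2 l1) l3
      refine ⟨_, hlt, ?_⟩
      obtain ⟨β, hβ, E, hE, hsub⟩ := ih _ hlt (φ m i g) (φ m i h)
        ((le_max_left _ _).trans (le_max_left _ _)) ((le_max_right _ _).trans (le_max_left _ _))
        (by rw [← h4]; exact le_max_right _ _)
      refine ⟨β, hβ, E, hE, fun x hx hxi => ?_⟩
      have h5 : N ((F (φ m i g * φ m i h) x)⁻¹ * (F (φ m i g) x * F (φ m i h) x)) = 0 := hsub hx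
      change N _ = 0
      rw [h1 x hxi, h2 x hxi, h3 x hxi, h4]
      exact h5

open Cardinal in
/-- Main construction: a seminormed group of size at most `κ` that is universal up to
null elements. -/
theorem exists_universal_seminormed (κ : Cardinal.{0}) (hκ : ℵ₀ < κ)
    (hpow : ∀ μ : Cardinal.{0}, ℵ₀ ≤ μ → μ < κ → 2 ^ μ ≤ κ) :
    ∃ (Q : Type) (_ : Group Q) (N : Q → ℝ), ConjSeminorm N ∧ #Q ≤ κ ∧
      ∀ (D : Type) (_ : Group D) (M : D → ℝ), ConjSeminorm M → #D ≤ κ →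
        ∃ F : D → Q, (∀ h, N (F h) = M h) ∧ ∀ g h, N ((F (g * h))⁻¹ * (F g * F h)) = 0 := by
  classical
  obtain ⟨G, _, N, hN, hG, hbase⟩ := exists_base
  let J := κ.ord.ToType
  have hJ : #J = κ := Cardinal.mk_ord_toType κ
  have hJne : Nonempty J := by
    rw [← Cardinal.mk_ne_zero_iff, hJ]; exact (aleph0_pos.trans hκ).ne'
  letI : OrderBot J := WellFoundedLT.toOrderBot J
  have hIic : ∀ β : J, #(Set.Iic β) < κ := by
    intro β
    have h1 : #(Set.Iio β) < κ := Cardinal.mk_Iio_toType_ord_lt β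
    rw [← Set.Iio_insert]
    refine (Cardinal.mk_insert_le).trans_lt ?_
    exact Cardinal.add_lt_of_lt hκ.le h1 (Cardinal.one_lt_aleph0.trans hκ)
  let T : Set (TSpace J → G) := {F | (∃ β, STree β F) ∧ ∃ c : ℝ, ∀ᶠ x in bigFilter J, N (F x) ≤ c}
  have hT : #T ≤ κ := by
    have hsub : T ⊆ ⋃ β : J, {F | STree β F} := by
      rintro F ⟨⟨β, hβ⟩, -⟩
      exact Set.mem_iUnion.2 ⟨β, hβ⟩
    refine (Cardinal.mk_le_mk_of_subset hsub).trans ((Cardinal.mk_iUnion_le _).trans ?_)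
    have : (⨆ β : J, #{F : TSpace J → G | STree β F}) ≤ κ := by
      refine ciSup_le' fun β => (mk_sTree_le hG β).trans ?_
      exact hpow _ (le_max_right _ _) (max_lt (hIic β) hκ)
    refine (mul_le_mul' hJ.le this).trans ?_
    rw [Cardinal.mul_eq_self hκ.le]
  have h1T : (1 : TSpace J → G) ∈ T :=
    ⟨⟨⊥, STree.const _ _⟩, 0, by simp [hN.one]⟩
  have hTne : Nonempty T := ⟨⟨_, h1T⟩⟩
  let ev : FreeGroup T →* (TSpace J → G) := FreeGroup.lift Subtype.val
  have hev : ∀ t : T, ev (FreeGroup.of t) = t.1 := fun t => FreeGroup.lift_apply_of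
  have hbd : ∀ w, ∃ c : ℝ, ∀ᶠ x in bigFilter J, N (ev w x) ≤ c := by
    intro w
    induction w using FreeGroup.induction_on with
    | C1 => exact ⟨0, by simp [hN.one]⟩
    | of t => rw [hev]; exact t.2.2
    | inv_of t ih => simpa [hN.inv] using ih
    | mul x y hx hy =>
      obtain ⟨c, hc⟩ := hx
      obtain ⟨c', hc'⟩ := hy
      refine ⟨c + c', ?_⟩
      filter_upwards [hc, hc'] with x h1 h2
      rw [map_mul]
      exact (hN.mul _ _).trans (add_le_add h1 h2)
  refine ⟨FreeGroup T, inferInstance, _, limsup_conjSeminorm hN (bigFilter J) ev hbd, ?_, ?_⟩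
  · rw [Cardinal.mk_freeGroup]
    exact max_le hT hκ.le
  · intro D _ M hM hD
    have hdn : Nonempty D := ⟨1⟩
    rw [← hJ] at hD
    obtain ⟨f⟩ := Cardinal.le_def _ _ |>.1 hD
    obtain ⟨F, hF1, hF2, hF3⟩ := exists_tree_map (J := J) (G := G) (N := N) (M := M)
      (Function.invFun f) (Function.invFun_surjective f.injective) (hbase D _ M hM)
    have hFT : ∀ h, F h ∈ T := by
      intro h
      refine ⟨hF1 h, M h + 1, ?_⟩
      filter_upwards [hF2 h 1 one_pos] with x hx
      have := abs_le.1 hx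
      linarith
    refine ⟨fun h => FreeGroup.of ⟨F h, hFT h⟩, ?_, ?_⟩
    · intro h
      simp only [hev]
      exact sInf_eq_of_tendsto (hF2 h)
    · intro g h
      refine sInf_eq_of_tendsto fun ε hε => ?_
      filter_upwards [hF3 g h] with x hx
      rw [map_mul, map_mul, map_inv, hev, hev, hev]
      change |N ((F (g * h) x)⁻¹ * (F g x * F h x)) - 0| ≤ ε
      rw [hx]; simpa using hε.le

open Cardinal in
theorem two_power_le_of_GCH {κ : Cardinal.{0}}
    (GCH : ∀ μ : Cardinal.{u}, Cardinal.aleph0 ≤ μ → 2 ^ μ = Order.succ μ) :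
    ∀ μ : Cardinal.{0}, ℵ₀ ≤ μ → μ < κ → 2 ^ μ ≤ κ := by
  intro μ h0 hμ
  have h1 := GCH (Cardinal.lift.{u} μ) (by simpa using h0)
  have h2 : Cardinal.lift.{u} (2 ^ μ) = Cardinal.lift.{u} (Order.succ μ) := by
    rw [Cardinal.lift_succ, ← h1]; simp
  rw [Cardinal.lift_inj.1 h2]
  exact Order.succ_le_of_lt hμ

/-- Under the generalized continuum hypothesis (`2^μ = μ⁺` for every infinite
cardinal `μ`), for every uncountable cardinal `κ` there is a group with complete bi-invariant
metric of density at most `κ` into which every group with bi-invariant metric of density at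
most `κ` embeds isometrically. -/
theorem exists_metrically_universal_group_of_density_GCH
    (GCH : ∀ μ : Cardinal, Cardinal.aleph0 ≤ μ → 2 ^ μ = Order.succ μ)
    (κ : Cardinal) (hκ : Cardinal.aleph0 < κ) :
    ∃ (G : Type) (_ : Group G) (_ : MetricSpace G),
      BiInvariantDist G ∧ CompleteSpace G ∧
      (∃ s : Set G, Dense s ∧ Cardinal.mk s ≤ κ) ∧
      ∀ (H : Type) (_ : Group H) (_ : MetricSpace H),
        BiInvariantDist H → (∃ t : Set H, Dense t ∧ Cardinal.mk t ≤ κ) →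
        ∃ f : H →* G, Function.Injective f ∧ Isometry f := by
  obtain ⟨Q, _, N, hN, hQ, hU⟩ :=
    exists_universal_seminormed κ hκ (two_power_le_of_GCH GCH)
  obtain ⟨G, iG, mG, hG, hGc, ι, hι, hιN⟩ := exists_completion hN
  refine ⟨G, iG, mG, hG, hGc, ⟨Set.range ι, hι, Cardinal.mk_range_le.trans hQ⟩, ?_⟩
  intro H _ _ hH ht
  obtain ⟨t, ht, htκ⟩ := ht
  have htn : Nonempty t := ht.nonempty.to_subtype
  let p : FreeGroup t →* H := FreeGroup.lift Subtype.val
  have hp : DenseRange p := by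
    refine Dense.mono ?_ ht
    intro h hh
    exact ⟨FreeGroup.of ⟨h, hh⟩, FreeGroup.lift_apply_of⟩
  have hD : Cardinal.mk (FreeGroup t) ≤ κ := by
    rw [Cardinal.mk_freeGroup]
    exact max_le htκ hκ.le
  obtain ⟨F, hF1, hF2⟩ := hU (FreeGroup t) inferInstance _ (hH.conjSeminorm.comp p) hD
  have hmul : ∀ g h, ι (F (g * h)) = ι (F g) * ι (F h) := by
    intro g h
    rw [← map_mul]
    apply dist_eq_zero.1
    rw [hG.dist_eq, ← map_inv, ← map_mul, hιN, hF2]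
  exact exists_extension hH hG p hp (MonoidHom.mk' (fun h => ι (F h)) hmul) fun a => by
    change dist 1 (ι (F a)) = _
    rw [hιN, hF1]
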